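/- Let Λ̃ = (λ̃_ℓ)_{ℓ≥0} be a nonnegative nonincreasing sequence in ℓ¹(ℕ₀), and let c > 1 be a constant with h_{⌊ℓ/2⌋}² ≤ c h_ℓ² for all ℓ. Then e_n(H_{Λ̃})² ≥ λ̃₀ (1 − 2cn λ̃₀ / (Σ_{ℓ≥1} λ̃_{2ℓ} + 2c λ̃₀)). -/

import Mathlib

open MeasureTheory RealInnerProductSpace

/-- Normalized Gegenbauer polynomials `G_ℓ` of index `(d−1)/2` with `G_ℓ(1) = 1`,
defined by the three-term recurrence
`G_{m+1}(t) = ((2m+d−1) t G_m(t) − m G_{m−1}(t))/(m+d−1)`. -/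
noncomputable def Geg (d : ℕ) : ℕ → ℝ → ℝ
  | 0 => fun _ => 1
  | 1 => fun t => t
  | n + 2 => fun t =>
      ((2 * (n : ℝ) + 1 + d) * t * Geg d (n + 1) t - ((n : ℝ) + 1) * Geg d n t) / ((n : ℝ) + d)

/-- Normalized integral against the Gegenbauer weight `w₀(t) = c₀(1−t²)^{(d−2)/2}` on `[−1,1]`. -/
noncomputable def gInt (d : ℕ) (f : ℝ → ℝ) : ℝ :=
  (∫ t in Set.Icc (-1 : ℝ) 1, ((1 - t ^ 2) ^ (((d : ℝ) - 2) / 2) : ℝ))⁻¹ *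
    ∫ t in Set.Icc (-1 : ℝ) 1, f t * (1 - t ^ 2) ^ (((d : ℝ) - 2) / 2)

/-- `h_k² = ⟨G_k²⟩`. -/
noncomputable def hsqG (d k : ℕ) : ℝ := gInt d fun t => Geg d k t ^ 2

/-- Gegenbauer linearization coefficients `C_k^{ℓ,s} = ⟨G_ℓ G_s G_k⟩ / h_k²`. -/
noncomputable def Ccoef (d k ℓ s : ℕ) : ℝ :=
  gInt d (fun t => Geg d ℓ t * Geg d s t * Geg d k t) / hsqG d k

/-- Convolution of sequences with respect to the Gegenbauer linearization coefficients. -/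
noncomputable def gconv (d : ℕ) (mu nu : ℕ → ℝ) (k : ℕ) : ℝ :=
  ∑' ℓ : ℕ, ∑' s : ℕ, Ccoef d k ℓ s * mu ℓ * nu s

/-- Kernel `K_Λ̃(x,y) = ∑_ℓ λ̃_ℓ G_ℓ(x⋅y)` of the space `H_Λ̃` on the sphere. -/
noncomputable def sphKernel (d : ℕ) (lam : ℕ → ℝ)
    (x y : EuclideanSpace ℝ (Fin (d + 1))) : ℝ :=
  ∑' ℓ : ℕ, lam ℓ * Geg d ℓ ⟪x, y⟫

/-- The squared optimal `n`-point quadrature error `e_n(H_Λ̃)²` for integration against the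
normalized surface measure on `S^d` over the unit ball of the RKHS `H_Λ̃` with kernel
`K_Λ̃(x,y) = ∑_ℓ λ̃_ℓ G_ℓ(x⋅y)`.  It is expressed via the standard RKHS identity for the squared
worst-case error of the rule `(c, x)`:
`‖h₀‖² − 2 ∑_j c_j h₀(x_j) + ∑_{j,k} c_j c_k K(x_j,x_k)`, where the representer of integration
is the constant `h₀ ≡ λ̃₀` with `‖h₀‖² = λ̃₀`. -/
noncomputable def enSq (d n : ℕ) (lam : ℕ → ℝ) : ℝ :=
  ⨅ (c : Fin n → ℝ)
    (x : Fin n → Metric.sphere (0 : EuclideanSpace ℝ (Fin (d + 1))) 1),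
      (lam 0 - 2 * lam 0 * ∑ j, c j +
        ∑ j, ∑ k, c j * c k * sphKernel d lam (x j) (x k))

/-! ### Part 1: positive definiteness of the Gegenbauer kernels (Fischer inner product) -/

section Fischer

open MvPolynomial

/-- Weight `α!` of a multi-index. -/
noncomputable def fw {N : ℕ} (α : Fin N →₀ ℕ) : ℝ := ∏ i, ((α i).factorial : ℝ)

theorem fw_nonneg {N : ℕ} (α : Fin N →₀ ℕ) : 0 ≤ fw α :=
  Finset.prod_nonneg fun _ _ => by positivity

theorem fw_add {N : ℕ} (α : Fin N →₀ ℕ) (i : Fin N) :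
    fw (α + Finsupp.single i 1) = fw α * (α i + 1) := by
  unfold fw
  rw [Fintype.prod_eq_mul_prod_compl i, Fintype.prod_eq_mul_prod_compl i (fun j => ((α j).factorial : ℝ))]
  have : ∏ j ∈ {i}ᶜ, (((α + Finsupp.single i 1 : Fin N →₀ ℕ) j).factorial : ℝ) =
      ∏ j ∈ {i}ᶜ, ((α j).factorial : ℝ) := by
    refine Finset.prod_congr rfl fun j hj => ?_
    have hj : j ≠ i := by simpa using hj
    simp [hj.symm]
  rw [this]
  simp [Nat.factorial_succ]
  ring

/-- Fischer inner product. -/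
noncomputable def fB (N : ℕ) : MvPolynomial (Fin N) ℝ →ₗ[ℝ] MvPolynomial (Fin N) ℝ →ₗ[ℝ] ℝ :=
  (basisMonomials (Fin N) ℝ).constr ℝ fun α => fw α • lcoeff ℝ α

theorem fB_monomial {N : ℕ} (α : Fin N →₀ ℕ) (a : ℝ) (q : MvPolynomial (Fin N) ℝ) :
    fB N (monomial α a) q = fw α * a * q.coeff α := by
  have h : monomial α a = a • basisMonomials (Fin N) ℝ α := by simp [smul_monomial]
  rw [h, map_smul, fB, Module.Basis.constr_basis]
  simp [lcoeff]
  ring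

theorem fB_eq_sum {N : ℕ} (p q : MvPolynomial (Fin N) ℝ) :
    fB N p q = ∑ α ∈ p.support, fw α * p.coeff α * q.coeff α := by
  conv_lhs => rw [p.as_sum]
  simp only [map_sum, LinearMap.sum_apply, fB_monomial]

theorem fB_self_nonneg {N : ℕ} (p : MvPolynomial (Fin N) ℝ) : 0 ≤ fB N p p := by
  rw [fB_eq_sum]
  refine Finset.sum_nonneg fun α _ => ?_
  rw [mul_assoc]
  exact mul_nonneg (fw_nonneg α) (mul_self_nonneg _)

theorem fB_X_mul {N : ℕ} (i : Fin N) (p q : MvPolynomial (Fin N) ℝ) :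
    fB N (X i * p) q = fB N p (pderiv i q) := by
  induction p using MvPolynomial.induction_on' with
  | monomial α a =>
    rw [X, monomial_mul, one_mul, add_comm, fB_monomial, fB_monomial, coeff_pderiv, fw_add]
    ring
  | add p q hp hq => rw [mul_add]; simp [hp, hq]

/-- Linear form `x ↦ x⋅y`. -/
noncomputable def fL {N : ℕ} (y : Fin N → ℝ) : MvPolynomial (Fin N) ℝ := ∑ i, C (y i) * X i

/-- The quadratic form `|x|²`. -/
noncomputable def fQ (N : ℕ) : MvPolynomial (Fin N) ℝ := ∑ i, X i * X i

/-- Directional derivative. -/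
noncomputable def fD {N : ℕ} (y : Fin N → ℝ) (p : MvPolynomial (Fin N) ℝ) :
    MvPolynomial (Fin N) ℝ := ∑ i, C (y i) * pderiv i p

/-- Laplacian. -/
noncomputable def fLap {N : ℕ} (p : MvPolynomial (Fin N) ℝ) :
    MvPolynomial (Fin N) ℝ := ∑ i, pderiv i (pderiv i p)

theorem pderiv_fL {N : ℕ} (y : Fin N → ℝ) (i : Fin N) : pderiv i (fL y) = C (y i) := by
  unfold fL
  rw [map_sum, Finset.sum_eq_single i]
  · simp
  · intro j _ hj
    simp [pderiv_X_of_ne hj]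
  · simp

theorem pderiv_fQ {N : ℕ} (i : Fin N) : pderiv i (fQ N) = 2 * X i := by
  unfold fQ
  rw [map_sum, Finset.sum_eq_single i]
  · simp; ring
  · intro j _ hj
    simp [pderiv_X_of_ne hj]
  · simp

theorem fB_fL_mul {N : ℕ} (y : Fin N → ℝ) (p q : MvPolynomial (Fin N) ℝ) :
    fB N (fL y * p) q = fB N p (fD y q) := by
  unfold fL fD
  rw [Finset.sum_mul, map_sum, LinearMap.sum_apply, map_sum]
  refine Finset.sum_congr rfl fun i _ => ?_
  rw [mul_assoc, C_mul', C_mul', map_smul, map_smul, LinearMap.smul_apply, fB_X_mul]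

theorem fB_fQ_mul {N : ℕ} (p q : MvPolynomial (Fin N) ℝ) :
    fB N (fQ N * p) q = fB N p (fLap q) := by
  unfold fQ fLap
  rw [Finset.sum_mul, map_sum, LinearMap.sum_apply, map_sum]
  refine Finset.sum_congr rfl fun i _ => ?_
  rw [mul_assoc, fB_X_mul, fB_X_mul]

theorem fD_mul {N : ℕ} (y : Fin N → ℝ) (p q : MvPolynomial (Fin N) ℝ) :
    fD y (p * q) = fD y p * q + p * fD y q := by
  unfold fD
  rw [Finset.sum_mul, Finset.mul_sum, ← Finset.sum_add_distrib]
  refine Finset.sum_congr rfl fun i _ => ?_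
  rw [pderiv_mul]; ring

theorem fD_fL {N : ℕ} (y : Fin N → ℝ) (hy : ∑ i, y i * y i = 1) : fD y (fL y) = 1 := by
  unfold fD
  simp only [pderiv_fL, ← C_mul]
  rw [← map_sum, hy, C_1]

theorem fD_fQ {N : ℕ} (y : Fin N → ℝ) : fD y (fQ N) = 2 * fL y := by
  unfold fD fL
  rw [Finset.mul_sum]
  refine Finset.sum_congr rfl fun i _ => ?_
  rw [pderiv_fQ]; ring

theorem fD_sub {N : ℕ} (y : Fin N → ℝ) (p q : MvPolynomial (Fin N) ℝ) :
    fD y (p - q) = fD y p - fD y q := by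
  simp [fD, mul_sub, Finset.sum_sub_distrib]

theorem fD_C_mul {N : ℕ} (y : Fin N → ℝ) (a : ℝ) (p : MvPolynomial (Fin N) ℝ) :
    fD y (C a * p) = C a * fD y p := by
  unfold fD
  rw [Finset.mul_sum]
  refine Finset.sum_congr rfl fun i _ => ?_
  rw [pderiv_C_mul]; ring

theorem fLap_sub {N : ℕ} (p q : MvPolynomial (Fin N) ℝ) :
    fLap (p - q) = fLap p - fLap q := by
  simp [fLap, Finset.sum_sub_distrib]

theorem fLap_C_mul {N : ℕ} (a : ℝ) (p : MvPolynomial (Fin N) ℝ) :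
    fLap (C a * p) = C a * fLap p := by
  unfold fLap
  rw [Finset.mul_sum]
  refine Finset.sum_congr rfl fun i _ => ?_
  rw [pderiv_C_mul, pderiv_C_mul]

theorem fLap_fL_mul {N : ℕ} (y : Fin N → ℝ) (p : MvPolynomial (Fin N) ℝ) :
    fLap (fL y * p) = 2 * fD y p + fL y * fLap p := by
  unfold fLap fD
  rw [Finset.mul_sum, Finset.mul_sum, ← Finset.sum_add_distrib]
  refine Finset.sum_congr rfl fun i _ => ?_
  rw [pderiv_mul, map_add, pderiv_mul, pderiv_mul, pderiv_fL, pderiv_C]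
  ring

theorem fLap_fQ_mul {N : ℕ} (p : MvPolynomial (Fin N) ℝ) :
    fLap (fQ N * p) = C (2 * (N : ℝ)) * p + 4 * ∑ i, X i * pderiv i p + fQ N * fLap p := by
  have h : ∀ i, pderiv i (pderiv i (fQ N * p)) =
      2 * p + 4 * (X i * pderiv i p) + fQ N * pderiv i (pderiv i p) := by
    intro i
    rw [pderiv_mul, map_add, pderiv_mul, pderiv_mul, pderiv_fQ, pderiv_mul, pderiv_X_self]
    have : pderiv i (2 : MvPolynomial (Fin N) ℝ) = 0 := by
      rw [show (2 : MvPolynomial (Fin N) ℝ) = C 2 from (map_ofNat C 2).symm, pderiv_C]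
    rw [this]; ring
  unfold fLap
  rw [Finset.sum_congr rfl fun i _ => h i, Finset.sum_add_distrib, Finset.sum_add_distrib,
    ← Finset.mul_sum, ← Finset.mul_sum]
  have h2 : (C (2 : ℝ) : MvPolynomial (Fin N) ℝ) = 2 := map_ofNat C 2
  simp only [Finset.sum_const, Finset.card_univ, Fintype.card_fin, nsmul_eq_mul, C_mul, h2,
    map_natCast, Finset.mul_sum]
  ring

theorem eval_fL {N : ℕ} (y x : Fin N → ℝ) : eval x (fL y) = ∑ i, y i * x i := by
  simp [fL]

theorem eval_fQ {N : ℕ} (x : Fin N → ℝ) : eval x (fQ N) = ∑ i, x i * x i := by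
  simp [fQ]

theorem isHom_fL {N : ℕ} (y : Fin N → ℝ) : (fL y).IsHomogeneous 1 := by
  refine IsHomogeneous.sum _ _ _ fun i _ => ?_
  simpa using (isHomogeneous_C (Fin N) (y i)).mul (isHomogeneous_X ℝ i)

theorem isHom_fQ (N : ℕ) : (fQ N).IsHomogeneous 2 := by
  refine IsHomogeneous.sum _ _ _ fun i _ => ?_
  exact (isHomogeneous_X ℝ i).mul (isHomogeneous_X ℝ i)

theorem isHom_fD {N : ℕ} (y : Fin N → ℝ) (n : ℕ) (p : MvPolynomial (Fin N) ℝ)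
    (hp : p.IsHomogeneous (n + 1)) : (fD y p).IsHomogeneous n := by
  refine IsHomogeneous.sum _ _ _ fun i _ => ?_
  simpa using (isHomogeneous_C (Fin N) (y i)).mul (hp.pderiv (i := i))

theorem fB_fL_pow {N : ℕ} (y : Fin N → ℝ) (n : ℕ) : ∀ p : MvPolynomial (Fin N) ℝ,
    p.IsHomogeneous n → fB N (fL y ^ n) p = n.factorial * eval y p := by
  induction n with
  | zero =>
    intro p hp
    rw [← totalDegree_zero_iff_isHomogeneous, totalDegree_eq_zero_iff_eq_C] at hp
    rw [pow_zero, show (1 : MvPolynomial (Fin N) ℝ) = monomial 0 1 from rfl, fB_monomial]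
    conv_rhs => rw [hp]
    simp [fw]
  | succ n ih =>
    intro p hp
    rw [pow_succ', fB_fL_mul, ih _ (isHom_fD y n p hp)]
    have h := congrArg (eval y) hp.sum_X_mul_pderiv
    have h2 : eval y (fD y p) = (n + 1) * eval y p := by
      simp [fD] at h ⊢
      exact h
    rw [h2, Nat.factorial_succ]
    push_cast; ring

/-- Homogenized zonal harmonics. -/
noncomputable def fZ (d : ℕ) (y : Fin (d + 1) → ℝ) : ℕ → MvPolynomial (Fin (d + 1)) ℝ
  | 0 => 1
  | 1 => fL y
  | n + 2 => C (((n : ℝ) + d)⁻¹) * (C (2 * (n : ℝ) + 1 + d) * (fL y * fZ d y (n + 1)) -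
      C ((n : ℝ) + 1) * (fQ (d + 1) * fZ d y n))

theorem fZ_rec (d : ℕ) (hd : 2 ≤ d) (y : Fin (d + 1) → ℝ) (n : ℕ) :
    C ((n : ℝ) + d) * fZ d y (n + 2) = C (2 * (n : ℝ) + 1 + d) * (fL y * fZ d y (n + 1)) -
      C ((n : ℝ) + 1) * (fQ (d + 1) * fZ d y n) := by
  rw [fZ, ← mul_assoc, ← C_mul, mul_inv_cancel₀, C_1, one_mul]
  have : (2 : ℝ) ≤ d := by exact_mod_cast hd
  positivity

theorem eval_fZ (d : ℕ) (y x : Fin (d + 1) → ℝ) (hx : ∑ i, x i * x i = 1) (n : ℕ) :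
    eval x (fZ d y n) = Geg d n (∑ i, y i * x i) := by
  induction n using Nat.strong_induction_on with
  | _ n ih =>
    match n with
    | 0 => simp [fZ, Geg]
    | 1 => simp [fZ, Geg, eval_fL]
    | n + 2 =>
      rw [fZ, Geg]
      simp only [eval_mul, eval_C, eval_sub, eval_fL, eval_fQ, hx, ih n (by omega),
        ih (n + 1) (by omega)]
      ring

theorem isHom_fZ (d : ℕ) (y : Fin (d + 1) → ℝ) (n : ℕ) : (fZ d y n).IsHomogeneous n := by
  induction n using Nat.strong_induction_on with
  | _ n ih =>
    match n with
    | 0 => exact isHomogeneous_one _ _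
    | 1 => exact isHom_fL y
    | n + 2 =>
      rw [fZ]
      have h1 := (isHom_fL y).mul (ih (n + 1) (by omega))
      have h2 := (isHom_fQ (d + 1)).mul (ih n (by omega))
      have e1 : 1 + (n + 1) = n + 2 := by ring
      have e2 : 2 + n = n + 2 := by ring
      rw [e1] at h1; rw [e2] at h2
      exact ((h1.C_mul _).sub (h2.C_mul _)).C_mul _

theorem fD_fZ (d : ℕ) (hd : 2 ≤ d) (y : Fin (d + 1) → ℝ) (hy : ∑ i, y i * y i = 1) (n : ℕ) :
    fD y (fZ d y (n + 1)) = C ((n : ℝ) + 1) * fZ d y n := by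
  have hd' : (2 : ℝ) ≤ d := by exact_mod_cast hd
  induction n using Nat.strong_induction_on with
  | _ n ih =>
    match n with
    | 0 => simp [fZ, fD_fL y hy]
    | 1 =>
      have h := congrArg (fD y) (fZ_rec d hd y 0)
      have hZ0 : fD y (fZ d y 0) = 0 := by simp [fZ, fD]
      rw [fD_C_mul, fD_sub, fD_C_mul, fD_C_mul, fD_mul, fD_mul, fD_fL y hy, fD_fQ,
        ih 0 (by omega), hZ0] at h
      have hne : (C ((0 : ℕ) + (d : ℝ)) : MvPolynomial (Fin (d + 1)) ℝ) ≠ 0 := by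
        rw [Ne, C_eq_zero]; push_cast; positivity
      apply mul_left_cancel₀ hne
      rw [h]
      simp [fZ]
      ring
    | n + 2 =>
      have h := congrArg (fD y) (fZ_rec d hd y (n + 1))
      have h3 := fZ_rec d hd y n
      rw [fD_C_mul, fD_sub, fD_C_mul, fD_C_mul, fD_mul, fD_mul, fD_fL y hy, fD_fQ,
        ih (n + 1) (by omega), ih n (by omega)] at h
      have hne : (C (((n + 1 : ℕ) : ℝ) + (d : ℝ)) : MvPolynomial (Fin (d + 1)) ℝ) ≠ 0 := by
        rw [Ne, C_eq_zero]; positivity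
      apply mul_left_cancel₀ hne
      rw [h]
      push_cast at h3 ⊢
      simp only [map_add, map_mul, map_natCast, map_one, map_ofNat] at h3 ⊢
      linear_combination (-((n : MvPolynomial (Fin (d + 1)) ℝ) + 2)) * h3

theorem fLap_fZ (d : ℕ) (hd : 2 ≤ d) (y : Fin (d + 1) → ℝ) (hy : ∑ i, y i * y i = 1) (n : ℕ) :
    fLap (fZ d y n) = 0 := by
  have hd' : (2 : ℝ) ≤ d := by exact_mod_cast hd
  induction n using Nat.strong_induction_on with
  | _ n ih =>
    match n with
    | 0 => simp [fZ, fLap]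
    | 1 => simp [fZ, fLap, pderiv_fL]
    | n + 2 =>
      have h := congrArg fLap (fZ_rec d hd y n)
      rw [fLap_C_mul, fLap_sub, fLap_C_mul, fLap_C_mul, fLap_fL_mul, fLap_fQ_mul,
        ih n (by omega), ih (n + 1) (by omega), fD_fZ d hd y hy,
        (isHom_fZ d y n).sum_X_mul_pderiv] at h
      have hne : (C ((n : ℝ) + (d : ℝ)) : MvPolynomial (Fin (d + 1)) ℝ) ≠ 0 := by
        rw [Ne, C_eq_zero]; positivity
      apply mul_left_cancel₀ hne
      rw [h]
      push_cast
      simp only [map_add, map_mul, map_natCast, map_one, map_ofNat, nsmul_eq_mul]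
      ring

/-- Leading coefficient. -/
noncomputable def fk (d : ℕ) : ℕ → ℝ
  | 0 => 1
  | 1 => 1
  | n + 2 => ((n : ℝ) + d)⁻¹ * ((2 * (n : ℝ) + 1 + d) * fk d (n + 1))

theorem fk_pos (d : ℕ) (hd : 2 ≤ d) (n : ℕ) : 0 < fk d n := by
  have hd' : (2 : ℝ) ≤ d := by exact_mod_cast hd
  induction n using Nat.strong_induction_on with
  | _ n ih =>
    match n with
    | 0 => simp [fk]
    | 1 => simp [fk]
    | n + 2 =>
      have := ih (n + 1) (by omega)
      rw [fk]
      positivity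

theorem fZ_leading (d : ℕ) (y : Fin (d + 1) → ℝ) (n : ℕ) :
    ∃ r, fZ d y n = C (fk d n) * fL y ^ n + fQ (d + 1) * r := by
  induction n using Nat.strong_induction_on with
  | _ n ih =>
    match n with
    | 0 => exact ⟨0, by simp [fZ, fk]⟩
    | 1 => exact ⟨0, by simp [fZ, fk]⟩
    | n + 2 =>
      obtain ⟨r, hr⟩ := ih (n + 1) (by omega)
      refine ⟨C (((n : ℝ) + d)⁻¹) * (C (2 * (n : ℝ) + 1 + d) * (fL y * r) -
        C ((n : ℝ) + 1) * fZ d y n), ?_⟩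
      rw [fZ, hr, fk, C_mul, C_mul]
      ring

theorem fB_fZ (d : ℕ) (hd : 2 ≤ d) (x y : Fin (d + 1) → ℝ) (hx : ∑ i, x i * x i = 1)
    (hy : ∑ i, y i * y i = 1) (n : ℕ) :
    fB (d + 1) (fZ d y n) (fZ d x n) = fk d n * n.factorial * Geg d n (∑ i, x i * y i) := by
  obtain ⟨r, hr⟩ := fZ_leading d y n
  rw [hr, map_add, LinearMap.add_apply, fB_fQ_mul, fLap_fZ d hd x hx, C_mul', map_smul,
    LinearMap.smul_apply, fB_fL_pow y n _ (isHom_fZ d x n), eval_fZ d x y hy]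
  simp
  ring

theorem Geg_psd (d : ℕ) (hd : 2 ≤ d) {ι : Type*} [Fintype ι] (w : ι → ℝ)
    (x : ι → EuclideanSpace ℝ (Fin (d + 1))) (hx : ∀ j, ‖x j‖ = 1) (n : ℕ) :
    0 ≤ ∑ j, ∑ k, w j * w k * Geg d n ⟪x j, x k⟫ := by
  have hx' : ∀ j, ∑ i, x j i * x j i = 1 := by
    intro j
    have h := real_inner_self_eq_norm_sq (x j)
    rw [hx j] at h
    rw [PiLp.inner_apply] at h
    simpa [pow_two] using h
  have hin : ∀ j k, ⟪x j, x k⟫ = ∑ i, x k i * x j i := by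
    intro j k
    simp [PiLp.inner_apply]
  have h := fB_self_nonneg (∑ j, C (w j) * fZ d (fun i => x j i) n)
  have e : fB (d + 1) (∑ j, C (w j) * fZ d (fun i => x j i) n)
      (∑ j, C (w j) * fZ d (fun i => x j i) n) =
      fk d n * n.factorial * ∑ j, ∑ k, w j * w k * Geg d n ⟪x j, x k⟫ := by
    simp only [map_sum, LinearMap.sum_apply, Finset.mul_sum, C_mul', map_smul,
      LinearMap.smul_apply, smul_eq_mul]
    rw [Finset.sum_comm]
    refine Finset.sum_congr rfl fun j _ => Finset.sum_congr rfl fun k _ => ?_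
    rw [fB_fZ d hd _ _ (hx' _) (hx' _), hin]
    ring
  rw [e] at h
  have := fk_pos d hd n
  exact nonneg_of_mul_nonneg_right h (by positivity)

end Fischer

/-! ### Part 2: orthogonality and the norms `h_k²` -/

section Ortho

theorem Geg_zero (d : ℕ) (t : ℝ) : Geg d 0 t = 1 := by simp [Geg]

theorem Geg_one (d : ℕ) (t : ℝ) : Geg d 1 t = t := by simp [Geg]

theorem Geg_at_one (d : ℕ) (hd : 2 ≤ d) (n : ℕ) : Geg d n 1 = 1 := by
  have hd' : (2 : ℝ) ≤ d := by exact_mod_cast hd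
  induction n using Nat.strong_induction_on with
  | _ n ih =>
    match n with
    | 0 => simp [Geg]
    | 1 => simp [Geg]
    | n + 2 =>
      rw [Geg]
      simp only [ih n (by omega), ih (n + 1) (by omega)]
      have : (n : ℝ) + d ≠ 0 := by positivity
      field_simp
      ring

/-- Three-term recurrence, valid for all `n` with truncated subtraction. -/
theorem Geg_rec (d : ℕ) (hd : 2 ≤ d) (n : ℕ) (t : ℝ) :
    (2 * (n : ℝ) + d - 1) * t * Geg d n t =
      ((n : ℝ) + d - 1) * Geg d (n + 1) t + n * Geg d (n - 1) t := by
  have hd' : (2 : ℝ) ≤ d := by exact_mod_cast hd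
  match n with
  | 0 => simp [Geg]
  | n + 1 =>
    rw [Nat.add_sub_cancel, Geg]
    have : (n : ℝ) + d ≠ 0 := by positivity
    push_cast
    field_simp
    ring

theorem Geg_differentiable (d : ℕ) (n : ℕ) : Differentiable ℝ (Geg d n) := by
  induction n using Nat.strong_induction_on with
  | _ n ih =>
    match n with
    | 0 => unfold Geg; fun_prop
    | 1 => unfold Geg; fun_prop
    | n + 2 =>
      have h1 := ih n (by omega)
      have h2 := ih (n + 1) (by omega)
      unfold Geg
      fun_prop

theorem Geg_deriv_raise (d : ℕ) (hd : 2 ≤ d) (n : ℕ) (t : ℝ) :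
    (1 - t ^ 2) * deriv (Geg d n) t =
      ((n : ℝ) + d - 1) * (t * Geg d n t - Geg d (n + 1) t) := by
  have hd' : (2 : ℝ) ≤ d := by exact_mod_cast hd
  induction n using Nat.strong_induction_on with
  | _ n ih =>
    match n with
    | 0 =>
      have : Geg d 0 = fun _ => 1 := by funext; simp [Geg]
      rw [this]
      simp [Geg]
    | 1 =>
      have : Geg d 1 = fun t => t := by funext; simp [Geg]
      rw [this]
      simp [Geg]
      have : (d : ℝ) ≠ 0 := by positivity
      field_simp
      ring
    | n + 2 =>
      have i1 := ih n (by omega)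
      have i2 := ih (n + 1) (by omega)
      have r1 := Geg_rec d hd (n + 1) t
      have r2 := Geg_rec d hd (n + 2) t
      have hne : (n : ℝ) + d ≠ 0 := by positivity
      have hder : ((n : ℝ) + d) * deriv (Geg d (n + 2)) t =
          (2 * (n : ℝ) + 1 + d) * (Geg d (n + 1) t + t * deriv (Geg d (n + 1)) t) -
            ((n : ℝ) + 1) * deriv (Geg d n) t := by
        have h1 := (Geg_differentiable d n t).hasDerivAt
        have h2 := (Geg_differentiable d (n + 1) t).hasDerivAt
        have h3 := (((((hasDerivAt_id t).const_mul (2 * (n : ℝ) + 1 + d)).mul h2).sub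
          (h1.const_mul ((n : ℝ) + 1))).div_const ((n : ℝ) + d))
        have e : Geg d (n + 2) = fun t => ((2 * (n : ℝ) + 1 + d) * t * Geg d (n + 1) t -
          ((n : ℝ) + 1) * Geg d n t) / ((n : ℝ) + d) := by
          funext s; rw [Geg]
        have h4 : HasDerivAt (Geg d (n + 2)) (((2 * ↑n + 1 + ↑d) * 1 * Geg d (n + 1) t +
            (2 * ↑n + 1 + ↑d) * id t * deriv (Geg d (n + 1)) t -
            (↑n + 1) * deriv (Geg d n) t) / (↑n + ↑d)) t := by rw [e]; exact h3
        rw [h4.deriv]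
        field_simp
        simp only [id]
        ring
      simp only [Nat.add_sub_cancel, show n + 2 - 1 = n + 1 from rfl] at r1 r2
      push_cast at *
      have hder2 := congrArg (fun z => (1 - t ^ 2) * z) hder
      apply mul_left_cancel₀ hne
      linear_combination hder2 + (2 * (n : ℝ) + 1 + d) * t * i2 - ((n : ℝ) + 1) * i1 +
        ((n : ℝ) + d - 1) * t * r1 - ((n : ℝ) + d) * r2

theorem Geg_deriv_lower (d : ℕ) (hd : 2 ≤ d) (n : ℕ) (t : ℝ) :
    (1 - t ^ 2) * deriv (Geg d n) t = n * (Geg d (n - 1) t - t * Geg d n t) := by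
  have h1 := Geg_deriv_raise d hd n t
  have h2 := Geg_rec d hd n t
  linear_combination h1 + h2

/-- The weight. -/
noncomputable def gw (d : ℕ) (t : ℝ) : ℝ := (1 - t ^ 2) ^ (((d : ℝ) - 2) / 2)

/-- Unnormalized integral. -/
noncomputable def gI (d : ℕ) (f : ℝ → ℝ) : ℝ := ∫ t in (-1 : ℝ)..1, f t * gw d t

theorem gw_continuous (d : ℕ) (hd : 2 ≤ d) : Continuous (gw d) := by
  have hd' : (2 : ℝ) ≤ d := by exact_mod_cast hd
  unfold gw
  refine Continuous.rpow_const (by fun_prop) fun x => Or.inr ?_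
  linarith

theorem gI_intervalIntegrable (d : ℕ) (hd : 2 ≤ d) (f : ℝ → ℝ) (hf : Continuous f) :
    IntervalIntegrable (fun t => f t * gw d t) volume (-1) 1 :=
  (hf.mul (gw_continuous d hd)).intervalIntegrable _ _

theorem gI_add (d : ℕ) (hd : 2 ≤ d) (f g : ℝ → ℝ) (hf : Continuous f) (hg : Continuous g) :
    gI d (fun t => f t + g t) = gI d f + gI d g := by
  unfold gI
  rw [← intervalIntegral.integral_add (gI_intervalIntegrable d hd f hf)
    (gI_intervalIntegrable d hd g hg)]
  refine intervalIntegral.integral_congr fun t _ => ?_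
  simp only
  ring

theorem gI_smul (d : ℕ) (a : ℝ) (f : ℝ → ℝ) : gI d (fun t => a * f t) = a * gI d f := by
  unfold gI
  rw [← intervalIntegral.integral_const_mul]
  refine intervalIntegral.integral_congr fun t _ => ?_
  simp only
  ring

theorem gI_ibp (d : ℕ) (hd : 2 ≤ d) (f f' : ℝ → ℝ) (hf : ∀ t, HasDerivAt f (f' t) t)
    (hc : Continuous fun t => (1 - t ^ 2) * f' t) :
    gI d (fun t => (1 - t ^ 2) * f' t) = d * gI d (fun t => t * f t) := by
  have hd' : (2 : ℝ) ≤ d := by exact_mod_cast hd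
  have hfc : Continuous f := continuous_iff_continuousAt.2 fun t => (hf t).continuousAt
  have key : ∫ t in (-1 : ℝ)..1,
      (((1 - t ^ 2) * f' t) * gw d t + (-(d : ℝ)) * (t * f t) * gw d t) = 0 := by
    have hF : ∀ t ∈ Set.uIcc (-1 : ℝ) 1,
        HasDerivAt (fun t => f t * (1 - t ^ 2) ^ ((d : ℝ) / 2))
          (((1 - t ^ 2) * f' t) * gw d t + (-(d : ℝ)) * (t * f t) * gw d t) t := by
      intro t ht
      rw [Set.uIcc_of_le (by norm_num)] at ht
      have h0 : 0 ≤ 1 - t ^ 2 := by nlinarith [ht.1, ht.2]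
      have h1 : HasDerivAt (fun t : ℝ => 1 - t ^ 2) (-(2 * t)) t := by
        have := ((hasDerivAt_id t).pow 2).const_sub 1
        simpa using this
      have h2 := h1.rpow_const (p := (d : ℝ) / 2) (Or.inr (by linarith))
      have h3 := (hf t).mul h2
      have e1 : (1 - t ^ 2) ^ ((d : ℝ) / 2) = (1 - t ^ 2) * gw d t := by
        unfold gw
        have : (d : ℝ) / 2 = 1 + ((d : ℝ) - 2) / 2 := by ring
        rw [this, Real.rpow_add_of_nonneg h0 (by norm_num) (by linarith), Real.rpow_one]
      have e2 : (1 - t ^ 2) ^ ((d : ℝ) / 2 - 1) = gw d t := by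
        unfold gw
        congr 1
        ring
      refine h3.congr_deriv ?_
      rw [e1, e2]
      ring
    rw [intervalIntegral.integral_eq_sub_of_hasDerivAt hF]
    · have : (d : ℝ) / 2 ≠ 0 := by positivity
      simp [Real.zero_rpow this]
    · apply Continuous.intervalIntegrable
      have := gw_continuous d hd
      exact (hc.mul this).add ((continuous_const.mul (continuous_id.mul hfc)).mul this)
  have h := gI_add d hd (fun t => (1 - t ^ 2) * f' t) (fun t => (-(d : ℝ)) * (t * f t)) hc
    (continuous_const.mul (continuous_id.mul hfc))
  have h0 : gI d (fun t => (1 - t ^ 2) * f' t + (-(d : ℝ)) * (t * f t)) = 0 := by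
    rw [← key]
    unfold gI
    refine intervalIntegral.integral_congr fun t _ => ?_
    simp only
    ring
  rw [gI_smul] at h
  linarith

/-- `⟨G_n G_m⟩`, unnormalized. -/
noncomputable def gJ (d n m : ℕ) : ℝ := gI d fun t => Geg d n t * Geg d m t

/-- `⟨t G_n G_m⟩`, unnormalized. -/
noncomputable def gT (d n m : ℕ) : ℝ := gI d fun t => t * (Geg d n t * Geg d m t)

theorem gJ_comm (d n m : ℕ) : gJ d n m = gJ d m n := by
  unfold gJ; congr 1; funext t; ring

theorem gT_comm (d n m : ℕ) : gT d n m = gT d m n := by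
  unfold gT; congr 1; funext t; ring

theorem gT_rec (d : ℕ) (hd : 2 ≤ d) (n m : ℕ) :
    (2 * (n : ℝ) + d - 1) * gT d n m =
      ((n : ℝ) + d - 1) * gJ d (n + 1) m + n * gJ d (n - 1) m := by
  have c := fun k => (Geg_differentiable d k).continuous
  unfold gT gJ
  rw [← gI_smul, ← gI_smul, ← gI_smul, ← gI_add d hd _ _ (by fun_prop) (by fun_prop)]
  congr 1
  funext t
  have := Geg_rec d hd n t
  linear_combination Geg d m t * this

theorem gT_ibp (d : ℕ) (hd : 2 ≤ d) (n m : ℕ) :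
    ((n : ℝ) - m - 1) * gT d n m =
      ((n : ℝ) + d - 1) * gJ d (n + 1) m - m * gJ d n (m - 1) := by
  have c := fun k => (Geg_differentiable d k).continuous
  have e : (fun t => (1 - t ^ 2) * (deriv (Geg d n) t * Geg d m t + Geg d n t * deriv (Geg d m) t))
      = fun t => ((n : ℝ) + d - 1 - m) * (t * (Geg d n t * Geg d m t)) +
        ((-((n : ℝ) + d - 1)) * (Geg d (n + 1) t * Geg d m t) +
          (m : ℝ) * (Geg d n t * Geg d (m - 1) t)) := by
    funext t
    have h1 := Geg_deriv_raise d hd n t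
    have h2 := Geg_deriv_lower d hd m t
    linear_combination Geg d m t * h1 + Geg d n t * h2
  have ct : Continuous fun t : ℝ => t * (Geg d n t * Geg d m t) :=
    continuous_id.mul ((c _).mul (c _))
  have h := gI_ibp d hd (fun t => Geg d n t * Geg d m t)
    (fun t => deriv (Geg d n) t * Geg d m t + Geg d n t * deriv (Geg d m) t)
    (fun t => (Geg_differentiable d n t).hasDerivAt.mul (Geg_differentiable d m t).hasDerivAt)
    (by
      rw [e]
      exact (continuous_const.mul ct).add ((continuous_const.mul ((c _).mul (c _))).add
        (continuous_const.mul ((c _).mul (c _)))))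
  rw [e, gI_add d hd _ _ (by fun_prop) (by fun_prop),
    gI_add d hd _ _ (by fun_prop) (by fun_prop), gI_smul, gI_smul, gI_smul] at h
  unfold gT gJ
  linear_combination h

theorem gJ_ortho (d : ℕ) (hd : 2 ≤ d) (s : ℕ) :
    ∀ n m, n + m = s → n ≠ m → gJ d n m = 0 := by
  have hd' : (2 : ℝ) ≤ d := by exact_mod_cast hd
  induction s using Nat.strong_induction_on with
  | _ s ih =>
    have main : ∀ n m, n + 1 + m = s → m < n + 1 → gJ d (n + 1) m = 0 := by
      intro n m hs hlt
      have h1 := gT_rec d hd n m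
      have h2 := gT_ibp d hd n m
      have z1 : (m : ℝ) * gJ d n (m - 1) = 0 := by
        rcases Nat.eq_zero_or_pos m with rfl | hm
        · simp
        · rw [ih (n + (m - 1)) (by omega) n (m - 1) rfl (by omega), mul_zero]
      have z2 : ((n : ℝ) - m - 1) * (n * gJ d (n - 1) m) = 0 := by
        rcases Nat.eq_zero_or_pos n with rfl | hn
        · simp
        · by_cases hnm : n - 1 = m
          · have : n = m + 1 := by omega
            subst this
            push_cast
            ring
          · rw [ih (n - 1 + m) (by omega) (n - 1) m rfl hnm]
            ring
      have h3 : ((n : ℝ) + m + d) * (n + d - 1) * gJ d (n + 1) m = 0 := by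
        linear_combination ((n : ℝ) - m - 1) * h1 - (2 * (n : ℝ) + d - 1) * h2 + z2 + (2 * (n : ℝ) + d - 1) * z1
      have hp : ((n : ℝ) + m + d) * (n + d - 1) ≠ 0 := by
        have : (0 : ℝ) < n + d - 1 := by
          have : (0 : ℝ) ≤ n := Nat.cast_nonneg n
          linarith
        positivity
      exact (mul_eq_zero.1 h3).resolve_left hp
    intro n m hs hne
    rcases lt_or_gt_of_ne hne with h | h
    · rw [gJ_comm]
      obtain ⟨m', rfl⟩ := Nat.exists_eq_succ_of_ne_zero (by omega : m ≠ 0)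
      exact main m' n (by omega) h
    · obtain ⟨n', rfl⟩ := Nat.exists_eq_succ_of_ne_zero (by omega : n ≠ 0)
      exact main n' m (by omega) h

theorem gJ_succ (d : ℕ) (hd : 2 ≤ d) (n : ℕ) :
    (2 * (n : ℝ) + d + 1) * ((n : ℝ) + d - 1) * gJ d (n + 1) (n + 1) =
      (2 * (n : ℝ) + d - 1) * ((n : ℝ) + 1) * gJ d n n := by
  have h1 := gT_rec d hd n (n + 1)
  have h2 := gT_rec d hd (n + 1) n
  rw [gT_comm] at h2
  rw [gJ_ortho d hd _ (n - 1) (n + 1) rfl (by omega)] at h1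
  rw [gJ_ortho d hd _ (n + 1 + 1) n rfl (by omega), Nat.add_sub_cancel] at h2
  push_cast at h2
  linear_combination (2 * (n : ℝ) + d - 1) * h2 - (2 * (n : ℝ) + d + 1) * h1

theorem hsqG_eq (d n : ℕ) : hsqG d n = (gJ d 0 0)⁻¹ * gJ d n n := by
  unfold hsqG gInt gJ gI
  rw [integral_Icc_eq_integral_Ioc, integral_Icc_eq_integral_Ioc,
    ← intervalIntegral.integral_of_le (by norm_num),
    ← intervalIntegral.integral_of_le (by norm_num)]
  simp only [Geg_zero, one_mul, gw, pow_two]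

theorem gJ_zero_pos (d : ℕ) (hd : 2 ≤ d) : 0 < gJ d 0 0 := by
  unfold gJ gI
  refine intervalIntegral.intervalIntegral_pos_of_pos_on ?_ ?_ (by norm_num)
  · have c := fun k => (Geg_differentiable d k).continuous
    exact gI_intervalIntegrable d hd _ ((c _).mul (c _))
  · intro t ht
    simp only [Geg_zero, one_mul, gw]
    exact Real.rpow_pos_of_pos (by nlinarith [ht.1, ht.2]) _

/-- `N_k = k!/(2λ)_k` with `2λ = d-1`. -/
noncomputable def gN (d : ℕ) : ℕ → ℝ
  | 0 => 1
  | n + 1 => gN d n * (((n : ℝ) + 1) / ((n : ℝ) + d - 1))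

theorem gN_pos (d : ℕ) (hd : 2 ≤ d) (n : ℕ) : 0 < gN d n := by
  have hd' : (2 : ℝ) ≤ d := by exact_mod_cast hd
  induction n with
  | zero => simp [gN]
  | succ n ih =>
    have : (0 : ℝ) < n + d - 1 := by
      have : (0 : ℝ) ≤ n := Nat.cast_nonneg n
      linarith
    rw [gN]
    positivity

theorem hsqG_formula (d : ℕ) (hd : 2 ≤ d) (n : ℕ) :
    hsqG d n = gN d n * (((d : ℝ) - 1) / (2 * n + d - 1)) := by
  have hd' : (2 : ℝ) ≤ d := by exact_mod_cast hd
  have h0 := gJ_zero_pos d hd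
  induction n with
  | zero =>
    rw [hsqG_eq, inv_mul_cancel₀ h0.ne', gN]
    have : (d : ℝ) - 1 ≠ 0 := by linarith
    simp [this]
  | succ n ih =>
    have hn : (0 : ℝ) ≤ n := Nat.cast_nonneg n
    have h := gJ_succ d hd n
    have h' : (2 * (n : ℝ) + d + 1) * ((n : ℝ) + d - 1) * hsqG d (n + 1) =
      (2 * (n : ℝ) + d - 1) * ((n : ℝ) + 1) * hsqG d n := by
      rw [hsqG_eq, hsqG_eq]
      linear_combination (gJ d 0 0)⁻¹ * h
    have p1 : 2 * (n : ℝ) + d + 1 ≠ 0 := by positivity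
    have p2 : (n : ℝ) + d - 1 ≠ 0 := by linarith
    have p3 : 2 * (n : ℝ) + d - 1 ≠ 0 := by linarith
    have p4 : 2 * ((n + 1 : ℕ) : ℝ) + d - 1 ≠ 0 := by push_cast; linarith
    have p5 : 2 * ((n : ℝ) + 1) + d - 1 ≠ 0 := by linarith
    apply mul_left_cancel₀ (mul_ne_zero p1 p2)
    rw [h', ih, gN]
    push_cast
    field_simp
    ring

theorem hsqG_pos (d : ℕ) (hd : 2 ≤ d) (n : ℕ) : 0 < hsqG d n := by
  have hd' : (2 : ℝ) ≤ d := by exact_mod_cast hd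
  have hn : (0 : ℝ) ≤ n := Nat.cast_nonneg n
  rw [hsqG_formula d hd]
  exact mul_pos (gN_pos d hd n) (div_pos (by linarith) (by linarith))

theorem hsqG_zero (d : ℕ) (hd : 2 ≤ d) : hsqG d 0 = 1 := by
  rw [hsqG_eq, inv_mul_cancel₀ (gJ_zero_pos d hd).ne']

theorem hsqG_anti (d : ℕ) (hd : 2 ≤ d) : Antitone (hsqG d) := by
  have hd' : (2 : ℝ) ≤ d := by exact_mod_cast hd
  refine antitone_nat_of_succ_le fun n => ?_
  have hn : (0 : ℝ) ≤ n := Nat.cast_nonneg n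
  rw [hsqG_formula d hd, hsqG_formula d hd, gN]
  have h1 := gN_pos d hd n
  have a1 : (n + 1 : ℝ) / (n + d - 1) ≤ 1 := by
    rw [div_le_one (by linarith)]; linarith
  have a2 : ((d : ℝ) - 1) / (2 * (n + 1 : ℕ) + d - 1) ≤ ((d : ℝ) - 1) / (2 * n + d - 1) := by
    apply div_le_div_of_nonneg_left (by linarith) (by linarith)
    push_cast; linarith
  have a3 : 0 ≤ ((d : ℝ) - 1) / (2 * (n + 1 : ℕ) + d - 1) :=
    div_nonneg (by linarith) (by push_cast; linarith)
  refine mul_le_mul ?_ a2 a3 h1.le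
  nlinarith

end Ortho

/-! ### Part 3: linearization of products (Dougall's formula) -/

section Linearization

/-- `λ = (d-1)/2`. -/
noncomputable def gl (d : ℕ) : ℝ := ((d : ℝ) - 1) / 2

theorem gl_pos (d : ℕ) (hd : 2 ≤ d) : 0 < gl d := by
  have hd' : (2 : ℝ) ≤ d := by exact_mod_cast hd
  unfold gl
  linarith

/-- `(λ)_n/n!`. -/
noncomputable def gA0 (d : ℕ) : ℕ → ℝ
  | 0 => 1
  | n + 1 => gA0 d n * ((gl d + n) / (n + 1))

/-- Extension of `gA0` by zero to negative integers. -/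
noncomputable def gA (d : ℕ) (j : ℤ) : ℝ := if j < 0 then 0 else gA0 d j.toNat

/-- `(2λ)_n/(λ)_{n+1}`. -/
noncomputable def gP0 (d : ℕ) : ℕ → ℝ
  | 0 => 1 / gl d
  | n + 1 => gP0 d n * ((2 * gl d + n) / (gl d + n + 1))

/-- `gP0` on integers. -/
noncomputable def gP (d : ℕ) (j : ℤ) : ℝ := gP0 d j.toNat

theorem gA0_pos (d : ℕ) (hd : 2 ≤ d) (n : ℕ) : 0 < gA0 d n := by
  have := gl_pos d hd
  induction n with
  | zero => simp [gA0]
  | succ n ih => rw [gA0]; positivity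

theorem gP0_pos (d : ℕ) (hd : 2 ≤ d) (n : ℕ) : 0 < gP0 d n := by
  have := gl_pos d hd
  induction n with
  | zero => rw [gP0]; positivity
  | succ n ih => rw [gP0]; positivity

theorem gA_neg (d : ℕ) (j : ℤ) (hj : j < 0) : gA d j = 0 := by simp [gA, hj]

theorem gA_nat (d : ℕ) (n : ℕ) : gA d n = gA0 d n := by simp [gA]

theorem gA_zero (d : ℕ) : gA d 0 = 1 := by simp [gA, gA0]

theorem gA_nonneg (d : ℕ) (hd : 2 ≤ d) (j : ℤ) : 0 ≤ gA d j := by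
  unfold gA
  split_ifs
  · exact le_rfl
  · exact (gA0_pos d hd _).le

theorem gA_succ (d : ℕ) (j : ℤ) (hj : 0 ≤ j) :
    gA d (j + 1) = gA d j * ((gl d + j) / (j + 1)) := by
  lift j to ℕ using hj
  rw [gA_nat, show ((j : ℤ) + 1) = ((j + 1 : ℕ) : ℤ) by push_cast; rfl, gA_nat, gA0]
  push_cast
  rfl

theorem gP_succ (d : ℕ) (j : ℤ) (hj : 0 ≤ j) :
    gP d (j + 1) = gP d j * ((2 * gl d + j) / (gl d + j + 1)) := by
  lift j to ℕ using hj
  rw [gP, gP, show ((j : ℤ) + 1).toNat = j + 1 by omega, Int.toNat_natCast, gP0]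
  push_cast
  rfl

/-- The symmetric part of the linearization coefficients. -/
noncomputable def gE (d : ℕ) (k l s : ℤ) : ℝ :=
  if Even (k + l + s) then
    gA d ((l + s - k) / 2) * gA d ((k + s - l) / 2) * gA d ((k + l - s) / 2) *
      gP d ((k + l + s) / 2)
  else 0

theorem gE_abc (d : ℕ) (a b c k l s : ℤ) (hk : k = b + c) (hl : l = a + c) (hs : s = a + b) :
    gE d k l s = gA d a * gA d b * gA d c * gP d (a + b + c) := by
  unfold gE
  rw [if_pos ⟨a + b + c, by omega⟩, show (l + s - k) / 2 = a by omega,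
    show (k + s - l) / 2 = b by omega, show (k + l - s) / 2 = c by omega,
    show (k + l + s) / 2 = a + b + c by omega]

theorem gE_swap12 (d : ℕ) (k l s : ℤ) : gE d k l s = gE d l k s := by
  unfold gE
  rw [add_comm k l]
  split_ifs
  · ring
  · rfl

theorem gE_swap23 (d : ℕ) (k l s : ℤ) : gE d k l s = gE d k s l := by
  unfold gE
  rw [show k + s + l = k + l + s by ring, add_comm l s]
  split_ifs
  · ring
  · rfl

theorem gE_nonneg (d : ℕ) (hd : 2 ≤ d) (k l s : ℤ) : 0 ≤ gE d k l s := by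
  unfold gE
  split_ifs
  · have h1 := gA_nonneg d hd ((l + s - k) / 2)
    have h2 := gA_nonneg d hd ((k + s - l) / 2)
    have h3 := gA_nonneg d hd ((k + l - s) / 2)
    have h4 : 0 < gP d ((k + l + s) / 2) := gP0_pos d hd _
    positivity
  · exact le_rfl

theorem gE_zero_of_gt (d : ℕ) (k l s : ℤ) (h : l + s < k) : gE d k l s = 0 := by
  unfold gE
  rw [gA_neg d ((l + s - k) / 2) (by omega)]
  simp

theorem gE_neg (d : ℕ) (k s : ℤ) : gE d k (-1) s = 0 := by
  rcases lt_or_ge k s with h | h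
  · rw [gE_swap23, gE_swap12, ]
    exact gE_zero_of_gt d _ _ _ (by omega)
  · exact gE_zero_of_gt d _ _ _ (by omega)

theorem gE_hyp (d : ℕ) (hd : 2 ≤ d) (k l s : ℤ) (hk : 0 ≤ k) (hl : 0 ≤ l) (hs : 0 ≤ s) :
    ((l : ℝ) + 1) / (l + gl d) * gE d k (l + 1) s +
      (2 * gl d + l - 1) / (l + gl d) * gE d k (l - 1) s =
    ((s : ℝ) + 1) / (s + gl d) * gE d k l (s + 1) +
      (2 * gl d + s - 1) / (s + gl d) * gE d k l (s - 1) := by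
  have hg := gl_pos d hd
  rcases Int.even_or_odd (k + l + s) with he | ⟨m, hm⟩
  · have z : ∀ x : ℤ, (x = k + l + s + 1 ∨ x = k + l + s - 1) → ¬ Even x := by
      rintro x hx ⟨r, hr⟩
      obtain ⟨q, hq⟩ := he
      omega
    unfold gE
    rw [if_neg (z _ (by omega)), if_neg (z _ (by omega)), if_neg (z _ (by omega)),
      if_neg (z _ (by omega))]
    simp
  · obtain ⟨a, ha⟩ : ∃ a, a = m + 1 - k := ⟨_, rfl⟩
    obtain ⟨b, hb⟩ : ∃ b, b = m - l := ⟨_, rfl⟩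
    obtain ⟨c, hc⟩ : ∃ c, c = m + 1 - s := ⟨_, rfl⟩
    rw [gE_abc d a b c k (l + 1) s (by omega) (by omega) (by omega),
      gE_abc d (a - 1) (b + 1) (c - 1) k (l - 1) s (by omega) (by omega) (by omega),
      gE_abc d a (b + 1) (c - 1) k l (s + 1) (by omega) (by omega) (by omega),
      gE_abc d (a - 1) b c k l (s - 1) (by omega) (by omega) (by omega)]
    have el : l = a + c - 1 := by omega
    have es : s = a + b := by omega
    have hlR : (0 : ℝ) ≤ l := by exact_mod_cast hl
    have hsR : (0 : ℝ) ≤ s := by exact_mod_cast hs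
    have n1 : (l : ℝ) + gl d ≠ 0 := by positivity
    have n2 : (s : ℝ) + gl d ≠ 0 := by positivity
    rw [show a - 1 + (b + 1) + (c - 1) = a + b + c - 1 by ring,
      show a + (b + 1) + (c - 1) = a + b + c by ring,
      show a - 1 + b + c = a + b + c - 1 by ring]
    rcases lt_or_ge a 0 with ha0 | ha0
    · rw [gA_neg d a ha0, gA_neg d (a - 1) (by omega)]; simp
    rcases lt_or_ge (b + 1) 0 with hb0 | hb0
    · rw [gA_neg d b (by omega), gA_neg d (b + 1) (by omega)]; simp
    rcases lt_or_ge c 0 with hc0 | hc0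
    · rw [gA_neg d c (by omega), gA_neg d (c - 1) (by omega)]; simp
    have hP := gP_succ d (a + b + c - 1) (by omega)
    rw [show a + b + c - 1 + 1 = a + b + c by ring] at hP
    have n3 : gl d + ((a + b + c - 1 : ℤ) : ℝ) + 1 ≠ 0 := by
      have : (0 : ℝ) ≤ ((a + b + c - 1 : ℤ) : ℝ) := by exact_mod_cast (by omega)
      positivity
    have hA : 0 < a → gA d a = gA d (a - 1) * ((gl d + (a - 1)) / a) := by
      intro h
      have := gA_succ d (a - 1) (by omega)
      rw [show a - 1 + 1 = a by ring] at this
      rw [this]; push_cast; ring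
    have hC : 0 < c → gA d c = gA d (c - 1) * ((gl d + (c - 1)) / c) := by
      intro h
      have := gA_succ d (c - 1) (by omega)
      rw [show c - 1 + 1 = c by ring] at this
      rw [this]; push_cast; ring
    have hB : 0 ≤ b → gA d (b + 1) = gA d b * ((gl d + b) / (b + 1)) := gA_succ d b
    subst el es
    push_cast at n1 n2 n3 hP ⊢
    rw [hP]
    rcases ha0.eq_or_lt with ha1 | ha1
    · -- a = 0
      subst ha1
      rw [gA_neg d (0 - 1) (by omega)]
      have hb1 : 0 ≤ b := by omega
      have hc1 : 0 < c := by omega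
      have hbR : (0 : ℝ) ≤ b := by exact_mod_cast hb1
      have hcR : (0 : ℝ) < c := by exact_mod_cast hc1
      have n4 : (b : ℝ) + 1 ≠ 0 := by positivity
      rw [hB hb1, hC hc1]
      push_cast at n1 n2 n3 ⊢
      field_simp
      ring
    have haR : (0 : ℝ) < a := by exact_mod_cast ha1
    rw [hA ha1]
    rcases hb0.eq_or_lt with hb1 | hb1
    · -- b = -1
      have hb2 : b = -1 := by omega
      subst hb2
      rw [gA_neg d (-1) (by omega), show (-1 : ℤ) + 1 = 0 by ring, gA_zero]
      have n5 : (a : ℝ) - 1 + gl d ≠ 0 := by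
        have : (1 : ℝ) ≤ a := by exact_mod_cast ha1
        have : (0 : ℝ) ≤ a - 1 := by linarith
        positivity
      push_cast at n1 n2 n3 ⊢
      field_simp
      ring
    have hb2 : 0 ≤ b := by omega
    have hbR : (0 : ℝ) ≤ b := by exact_mod_cast hb2
    have n4 : (b : ℝ) + 1 ≠ 0 := by positivity
    rcases hc0.eq_or_lt with hc1 | hc1
    · subst hc1
      rw [gA_neg d (0 - 1) (by omega)]
      push_cast at n1 n2 n3 ⊢
      field_simp
      ring
    have hcR : (0 : ℝ) < c := by exact_mod_cast hc1
    rw [hB hb2, hC hc1]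
    field_simp
    ring

/-- The linearization coefficients. -/
noncomputable def gC (d k l s : ℕ) : ℝ := gN d l * gN d s * (gl d + k) * gE d k l s

theorem gC_nonneg (d : ℕ) (hd : 2 ≤ d) (k l s : ℕ) : 0 ≤ gC d k l s := by
  have h1 := gN_pos d hd l
  have h2 := gN_pos d hd s
  have h3 := gl_pos d hd
  have h4 := gE_nonneg d hd k l s
  unfold gC
  positivity

theorem gC_comm (d k l s : ℕ) : gC d k l s = gC d k s l := by
  unfold gC
  rw [gE_swap23]; ring

theorem gC_zero_of_gt (d k l s : ℕ) (h : l + s < k) : gC d k l s = 0 := by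
  unfold gC
  rw [gE_zero_of_gt d k l s (by exact_mod_cast h), mul_zero]

theorem gC_transfer (d : ℕ) (hd : 2 ≤ d) (k l s : ℕ) :
    gC d k l s * hsqG d k = gC d l k s * hsqG d l := by
  have h3 := gl_pos d hd
  have e : ∀ n : ℕ, hsqG d n = gN d n * (gl d / (gl d + n)) := by
    intro n
    rw [hsqG_formula d hd]
    congr 1
    have : gl d + n ≠ 0 := by positivity
    have h2 : 2 * (n : ℝ) + d - 1 ≠ 0 := by
      have : 2 * (n : ℝ) + d - 1 = 2 * (gl d + n) := by unfold gl; ring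
      rw [this]; positivity
    rw [div_eq_div_iff h2 this]
    unfold gl
    ring
  rw [e, e]
  unfold gC
  rw [gE_swap12]
  have h1 : gl d + k ≠ 0 := by positivity
  have h2 : gl d + l ≠ 0 := by positivity
  field_simp

theorem gNAP (d : ℕ) (hd : 2 ≤ d) (l : ℕ) : gN d l * (gl d + l) * (gA0 d l * gP0 d l) = 1 := by
  have h3 := gl_pos d hd
  induction l with
  | zero => simp [gN, gA0, gP0]; field_simp
  | succ n ih =>
    rw [gN, gA0, gP0]
    have e : (n : ℝ) + d - 1 = 2 * gl d + n := by unfold gl; ring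
    rw [e]
    push_cast
    have h1 : 2 * gl d + (n : ℝ) ≠ 0 := by positivity
    have h2 : gl d + (n : ℝ) + 1 ≠ 0 := by positivity
    have h4 : (n : ℝ) + 1 ≠ 0 := by positivity
    refine Eq.trans ?_ ih
    field_simp
    ring

theorem gC_right_zero (d : ℕ) (hd : 2 ≤ d) (k l : ℕ) : gC d k l 0 = if k = l then 1 else 0 := by
  split_ifs with h
  · subst h
    unfold gC
    rw [gE_abc d 0 0 k k k ((0 : ℕ) : ℤ) (by simp) (by simp) (by simp), gA_zero, zero_add, zero_add,
      gA_nat, gP, Int.toNat_natCast]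
    have h0 : gN d 0 = 1 := by simp [gN]
    rw [h0]
    linear_combination gNAP d hd k
  · unfold gC
    rcases lt_or_gt_of_ne h with h | h
    · rw [gE_swap12, gE_zero_of_gt d _ _ _ (by push_cast; omega)]; simp
    · rw [gE_zero_of_gt d _ _ _ (by push_cast; omega)]; simp

theorem gC_hyp (d : ℕ) (hd : 2 ≤ d) (k l s : ℕ) :
    ((l : ℝ) + d - 1) / (2 * l + d - 1) * gC d k (l + 1) s +
      (l : ℝ) / (2 * l + d - 1) * gC d k (l - 1) s =
    ((s : ℝ) + d - 1) / (2 * s + d - 1) * gC d k l (s + 1) +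
      (s : ℝ) / (2 * s + d - 1) * gC d k l (s - 1) := by
  have h3 := gl_pos d hd
  have key : ∀ l s : ℕ, ((l : ℝ) + d - 1) / (2 * l + d - 1) * gC d k (l + 1) s +
      (l : ℝ) / (2 * l + d - 1) * gC d k (l - 1) s =
      gN d l * gN d s * (gl d + k) / 2 * (((l : ℝ) + 1) / (l + gl d) * gE d k (l + 1) s +
      (2 * gl d + l - 1) / (l + gl d) * gE d k (l - 1) s) := by
    intro l s
    have e1 : (l : ℝ) + d - 1 = 2 * gl d + l := by unfold gl; ring
    have e2 : 2 * (l : ℝ) + d - 1 = 2 * (l + gl d) := by unfold gl; ring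
    have n1 : 2 * gl d + (l : ℝ) ≠ 0 := by positivity
    have n2 : (l : ℝ) + gl d ≠ 0 := by positivity
    have p1 : ((l : ℝ) + d - 1) / (2 * l + d - 1) * gC d k (l + 1) s =
        gN d l * gN d s * (gl d + k) / 2 * (((l : ℝ) + 1) / (l + gl d) * gE d k (l + 1) s) := by
      unfold gC
      rw [gN, e2, e1]
      push_cast
      field_simp
    have p2 : (l : ℝ) / (2 * l + d - 1) * gC d k (l - 1) s =
        gN d l * gN d s * (gl d + k) / 2 *
          ((2 * gl d + l - 1) / (l + gl d) * gE d k (l - 1) s) := by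
      rw [e2]
      cases l with
      | zero => rw [Nat.cast_zero, Nat.cast_zero, zero_sub, gE_neg]; simp
      | succ l =>
        unfold gC
        rw [Nat.add_sub_cancel, gN]
        have e3 : (l : ℝ) + d - 1 = 2 * gl d + l := by unfold gl; ring
        have n3 : 2 * gl d + (l : ℝ) ≠ 0 := by positivity
        rw [e3]
        push_cast at n2 ⊢
        rw [show (l : ℤ) + 1 - 1 = l by ring]
        field_simp
        ring
    rw [p1, p2]; ring
  rw [key l s, gC_comm d k l (s + 1), gC_comm d k l (s - 1), key s l]
  have h := gE_hyp d hd k l s (by positivity) (by positivity) (by positivity)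
  rw [gE_swap23 d k ((s : ℤ) + 1), gE_swap23 d k ((s : ℤ) - 1)]
  push_cast at h
  rw [h]
  ring

theorem Geg_mul (d : ℕ) (hd : 2 ≤ d) (t : ℝ) (s : ℕ) : ∀ l M : ℕ, l + s < M →
    Geg d l t * Geg d s t = ∑ k ∈ Finset.range M, gC d k l s * Geg d k t := by
  have hd' : (2 : ℝ) ≤ d := by exact_mod_cast hd
  induction s using Nat.strong_induction_on with
  | _ s ih =>
    intro l M hM
    cases s with
    | zero =>
      simp only [gC_right_zero d hd, ite_mul, one_mul, zero_mul]
      rw [Finset.sum_ite_eq' (Finset.range M) l, if_pos (by simpa using hM), Geg_zero, mul_one]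
    | succ s =>
      have hsn : (0 : ℝ) ≤ s := Nat.cast_nonneg s
      have hln : (0 : ℝ) ≤ l := Nat.cast_nonneg l
      have i1 := ih s (by omega) (l + 1) M (by omega)
      have i2 := ih s (by omega) (l - 1) M (by omega)
      have i3 := ih (s - 1) (by omega) l M (by omega)
      have r1 := Geg_rec d hd l t
      have r2 := Geg_rec d hd s t
      have nl : 2 * (l : ℝ) + d - 1 ≠ 0 := by linarith
      have ns : 2 * (s : ℝ) + d - 1 ≠ 0 := by linarith
      have nn : ((s : ℝ) + d - 1) / (2 * s + d - 1) ≠ 0 := div_ne_zero (by linarith) ns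
      have h1 : t * Geg d l t = ((l : ℝ) + d - 1) / (2 * l + d - 1) * Geg d (l + 1) t +
          (l : ℝ) / (2 * l + d - 1) * Geg d (l - 1) t := by
        rw [div_mul_eq_mul_div, div_mul_eq_mul_div, ← add_div, eq_div_iff nl]
        linear_combination r1
      have h2 : t * Geg d s t = ((s : ℝ) + d - 1) / (2 * s + d - 1) * Geg d (s + 1) t +
          (s : ℝ) / (2 * s + d - 1) * Geg d (s - 1) t := by
        rw [div_mul_eq_mul_div, div_mul_eq_mul_div, ← add_div, eq_div_iff ns]
        linear_combination r2
      have hs : ((s : ℝ) + d - 1) / (2 * s + d - 1) *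
          ∑ k ∈ Finset.range M, gC d k l (s + 1) * Geg d k t =
          ((l : ℝ) + d - 1) / (2 * l + d - 1) *
            ∑ k ∈ Finset.range M, gC d k (l + 1) s * Geg d k t +
          (l : ℝ) / (2 * l + d - 1) * ∑ k ∈ Finset.range M, gC d k (l - 1) s * Geg d k t -
          (s : ℝ) / (2 * s + d - 1) * ∑ k ∈ Finset.range M, gC d k l (s - 1) * Geg d k t := by
        simp only [Finset.mul_sum]
        rw [← Finset.sum_add_distrib, ← Finset.sum_sub_distrib]
        refine Finset.sum_congr rfl fun k _ => ?_
        have := gC_hyp d hd k l s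
        linear_combination (-Geg d k t) * this
      apply mul_left_cancel₀ nn
      rw [hs, ← i1, ← i2, ← i3]
      linear_combination Geg d s t * h1 - Geg d l t * h2

theorem gC_sum (d : ℕ) (hd : 2 ≤ d) (l s M : ℕ) (hM : l + s < M) :
    ∑ k ∈ Finset.range M, gC d k l s = 1 := by
  have h := Geg_mul d hd 1 s l M hM
  simp only [Geg_at_one d hd, mul_one] at h
  exact h.symm

theorem gC_zero (d : ℕ) (hd : 2 ≤ d) (l s : ℕ) : gC d 0 l s = if l = s then hsqG d l else 0 := by
  have h := gC_transfer d hd 0 l s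
  rw [hsqG_zero d hd, mul_one, gC_comm d l 0 s, gC_right_zero d hd] at h
  rw [h]
  split_ifs <;> simp

end Linearization

/-! ### The final argument -/
section Final

theorem vybiral_sq {n : ℕ} (M : Matrix (Fin n) (Fin n) ℝ) (hM : M.PosSemidef) (w : Fin n → ℝ) :
    (∑ i, w i * M i i) ^ 2 ≤ n * ∑ i, ∑ j, w i * w j * (M i j * M i j) := by
  classical
  obtain ⟨B, hB⟩ : ∃ B : Matrix (Fin n) (Fin n) ℝ, M = B.conjTranspose * B := by
    open scoped MatrixOrder Matrix.Norms.L2Operator in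
    exact CStarAlgebra.nonneg_iff_eq_star_mul_self.mp hM.nonneg
  have hij : ∀ i j, M i j = ∑ a, B a i * B a j := by
    intro i j
    rw [hB, Matrix.mul_apply]
    simp [Matrix.conjTranspose_apply]
  set V : Fin n → Fin n → ℝ := fun a b => ∑ i, w i * (B a i * B b i) with hV
  have h1 : ∑ i, w i * M i i = ∑ a, V a a := by
    simp only [hij, hV, Finset.mul_sum]
    rw [Finset.sum_comm]
  have h2 : ∑ i, ∑ j, w i * w j * (M i j * M i j) = ∑ a, ∑ b, V a b ^ 2 := by
    simp only [hij, hV, pow_two, Finset.sum_mul_sum]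
    simp only [Finset.mul_sum]
    calc _ = ∑ i, ∑ a, ∑ j, ∑ b, w i * w j * (B a i * B a j * (B b i * B b j)) :=
          Finset.sum_congr rfl fun i _ => Finset.sum_comm
      _ = ∑ a, ∑ i, ∑ j, ∑ b, w i * w j * (B a i * B a j * (B b i * B b j)) := Finset.sum_comm
      _ = ∑ a, ∑ i, ∑ b, ∑ j, w i * w j * (B a i * B a j * (B b i * B b j)) :=
          Finset.sum_congr rfl fun a _ => Finset.sum_congr rfl fun i _ => Finset.sum_comm
      _ = ∑ a, ∑ b, ∑ i, ∑ j, w i * w j * (B a i * B a j * (B b i * B b j)) :=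
          Finset.sum_congr rfl fun a _ => Finset.sum_comm
      _ = _ := by
          refine Finset.sum_congr rfl fun a _ => Finset.sum_congr rfl fun b _ =>
            Finset.sum_congr rfl fun i _ => Finset.sum_congr rfl fun j _ => ?_
          ring
  rw [h1, h2]
  have h3 := sq_sum_le_card_mul_sum_sq (s := (Finset.univ : Finset (Fin n))) (f := fun a => V a a)
  rw [Finset.card_univ, Fintype.card_fin] at h3
  refine h3.trans (mul_le_mul_of_nonneg_left ?_ (Nat.cast_nonneg n))
  refine Finset.sum_le_sum fun a _ => ?_
  exact Finset.single_le_sum (f := fun b => V a b ^ 2) (fun b _ => sq_nonneg _) (Finset.mem_univ a)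

/-- The auxiliary sequence. -/
noncomputable def fmu (c : ℝ) (lam : ℕ → ℝ) (l : ℕ) : ℝ := if l = 0 then 2 * c * lam 0 else lam (2 * l)

theorem fmu_nonneg (c : ℝ) (hc : 1 < c) (lam : ℕ → ℝ) (hlam : ∀ k, 0 ≤ lam k) (l : ℕ) :
    0 ≤ fmu c lam l := by
  unfold fmu
  have := hlam 0
  split_ifs
  · positivity
  · exact hlam _

theorem gC_sum_le (d : ℕ) (hd : 2 ≤ d) (k s L : ℕ) : ∑ l ∈ Finset.range L, gC d l k s ≤ 1 := by
  rw [← gC_sum d hd k s (L + (k + s + 1)) (by omega)]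
  exact Finset.sum_le_sum_of_subset_of_nonneg (Finset.range_subset_range.2 (by omega))
    fun i _ _ => gC_nonneg d hd i k s

theorem conv_bound (d : ℕ) (hd : 2 ≤ d) (lam : ℕ → ℝ)
    (hlam : ∀ k, 0 ≤ lam k) (hmono : ∀ k l, k ≤ l → lam l ≤ lam k)
    (c : ℝ) (hc : 1 < c) (hch : ∀ l : ℕ, hsqG d (l / 2) ≤ c * hsqG d l) (k L : ℕ) :
    ∑ l ∈ Finset.range L, ∑ s ∈ Finset.range L, fmu c lam l * fmu c lam s * gC d k l s ≤
      2 * c * lam k * ∑ l ∈ Finset.range L, fmu c lam l := by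
  have hm := fmu_nonneg c hc lam hlam
  rcases Nat.eq_zero_or_pos k with rfl | hk
  · rw [Finset.mul_sum]
    refine Finset.sum_le_sum fun l hl => ?_
    simp only [gC_zero d hd, mul_ite, mul_zero]
    rw [Finset.sum_ite_eq, if_pos hl]
    have h1 : fmu c lam l ≤ 2 * c * lam 0 := by
      unfold fmu
      split_ifs
      · exact le_rfl
      · have := hmono 0 (2 * l) (Nat.zero_le _)
        nlinarith [hlam 0]
    have h2 : hsqG d l ≤ 1 := by
      rw [← hsqG_zero d hd]; exact hsqG_anti d hd (Nat.zero_le l)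
    have h3 := hsqG_pos d hd l
    calc fmu c lam l * fmu c lam l * hsqG d l ≤ fmu c lam l * fmu c lam l * 1 :=
          mul_le_mul_of_nonneg_left h2 (mul_nonneg (hm l) (hm l))
      _ = fmu c lam l * fmu c lam l := mul_one _
      _ ≤ _ := mul_le_mul_of_nonneg_right h1 (hm l)
  · have key : ∀ l s, k ≤ 2 * l → fmu c lam l * gC d k l s ≤ c * lam k * gC d l k s := by
      intro l s h
      have h1 : fmu c lam l ≤ lam k := by
        unfold fmu
        rw [if_neg (by omega)]
        exact hmono _ _ h
      have h2 : hsqG d l ≤ c * hsqG d k := (hsqG_anti d hd (by omega)).trans (hch k)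
      have h3 : gC d k l s ≤ c * gC d l k s := by
        have h4 := gC_transfer d hd k l s
        have h5 := hsqG_pos d hd k
        have h6 := gC_nonneg d hd l k s
        refine le_of_mul_le_mul_right ?_ h5
        rw [h4]
        nlinarith
      calc _ ≤ lam k * (c * gC d l k s) :=
            mul_le_mul h1 h3 (gC_nonneg d hd _ _ _) (hlam k)
        _ = _ := by ring
    have key2 : ∀ l s, fmu c lam l * fmu c lam s * gC d k l s ≤
        c * lam k * (fmu c lam s * gC d l k s + fmu c lam l * gC d s k l) := by
      intro l s
      have hck : 0 ≤ c * lam k := mul_nonneg (by linarith) (hlam k)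
      have a1 := mul_nonneg (hm s) (gC_nonneg d hd l k s)
      have a2 := mul_nonneg (hm l) (gC_nonneg d hd s k l)
      have b1 := mul_nonneg hck a1
      have b2 := mul_nonneg hck a2
      by_cases h1 : k ≤ 2 * l
      · have := mul_le_mul_of_nonneg_left (key l s h1) (hm s)
        linarith
      · by_cases h2 : k ≤ 2 * s
        · have := mul_le_mul_of_nonneg_left (key s l h2) (hm l)
          rw [gC_comm d k s l] at this
          linarith
        · rw [gC_zero_of_gt d k l s (by omega)]
          linarith
    have e1 : ∑ l ∈ Finset.range L, ∑ s ∈ Finset.range L, fmu c lam l * gC d s k l ≤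
        ∑ l ∈ Finset.range L, fmu c lam l := by
      refine Finset.sum_le_sum fun l _ => ?_
      rw [← Finset.mul_sum]
      exact mul_le_of_le_one_right (hm l) (gC_sum_le d hd k l L)
    have hck : 0 ≤ c * lam k := mul_nonneg (by linarith) (hlam k)
    calc _ ≤ ∑ l ∈ Finset.range L, ∑ s ∈ Finset.range L,
          c * lam k * (fmu c lam s * gC d l k s + fmu c lam l * gC d s k l) :=
          Finset.sum_le_sum fun l _ => Finset.sum_le_sum fun s _ => key2 l s
      _ = c * lam k * (∑ l ∈ Finset.range L, ∑ s ∈ Finset.range L, fmu c lam s * gC d l k s +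
          ∑ l ∈ Finset.range L, ∑ s ∈ Finset.range L, fmu c lam l * gC d s k l) := by
          rw [← Finset.sum_add_distrib, Finset.mul_sum]
          refine Finset.sum_congr rfl fun l _ => ?_
          rw [← Finset.sum_add_distrib, Finset.mul_sum]
      _ ≤ c * lam k * (∑ l ∈ Finset.range L, fmu c lam l + ∑ l ∈ Finset.range L, fmu c lam l) := by
          refine mul_le_mul_of_nonneg_left (add_le_add ?_ e1) hck
          rw [Finset.sum_comm]
          exact e1
      _ = _ := by ring

theorem Geg_abs_le (d : ℕ) (hd : 2 ≤ d) (k : ℕ) (x y : EuclideanSpace ℝ (Fin (d + 1)))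
    (hx : ‖x‖ = 1) (hy : ‖y‖ = 1) : |Geg d k ⟪x, y⟫| ≤ 1 := by
  have hx' : ⟪x, x⟫ = 1 := by rw [real_inner_self_eq_norm_sq, hx]; norm_num
  have hy' : ⟪y, y⟫ = 1 := by rw [real_inner_self_eq_norm_sq, hy]; norm_num
  have hu : ∀ j : Fin 2, ‖(![x, y] : Fin 2 → EuclideanSpace ℝ (Fin (d + 1))) j‖ = 1 := by
    intro j; fin_cases j <;> simp [hx, hy]
  have h1 := Geg_psd d hd ![1, 1] ![x, y] hu k
  have h2 := Geg_psd d hd ![1, -1] ![x, y] hu k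
  simp only [Fin.sum_univ_two, Matrix.cons_val_zero, Matrix.cons_val_one, hx', hy',
    Geg_at_one d hd, real_inner_comm x y] at h1 h2
  rw [abs_le]
  rw [real_inner_comm y x] at h1 h2 ⊢
  constructor <;> linarith

theorem main_ineq (d : ℕ) (hd : 2 ≤ d) (lam : ℕ → ℝ)
    (hlam : ∀ k, 0 ≤ lam k) (hmono : ∀ k l, k ≤ l → lam l ≤ lam k) (hsum : Summable lam)
    (c : ℝ) (hc : 1 < c) (hch : ∀ l : ℕ, hsqG d (l / 2) ≤ c * hsqG d l) (n : ℕ)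
    (w : Fin n → ℝ) (x : Fin n → EuclideanSpace ℝ (Fin (d + 1))) (hx : ∀ j, ‖x j‖ = 1) :
    0 ≤ ∑ j, ∑ k, w j * w k * sphKernel d lam (x j) (x k) ∧
    ∀ L, ((∑ l ∈ Finset.range L, fmu c lam l) * ∑ j, w j) ^ 2 ≤
      n * (2 * c * (∑ l ∈ Finset.range L, fmu c lam l) *
        ∑ j, ∑ k, w j * w k * sphKernel d lam (x j) (x k)) := by
  have hm := fmu_nonneg c hc lam hlam
  set q : ℕ → ℝ := fun k => ∑ i, ∑ j, w i * w j * Geg d k ⟪x i, x j⟫ with hq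
  have hq0 : ∀ k, 0 ≤ q k := fun k => Geg_psd d hd w x hx k
  have hs : ∀ i j, HasSum (fun k => lam k * Geg d k ⟪x i, x j⟫) (sphKernel d lam (x i) (x j)) := by
    intro i j
    refine Summable.hasSum (Summable.of_norm_bounded hsum fun k => ?_)
    rw [Real.norm_eq_abs, abs_mul, abs_of_nonneg (hlam k)]
    exact mul_le_of_le_one_right (hlam k) (Geg_abs_le d hd k _ _ (hx i) (hx j))
  have hQ : HasSum (fun k => lam k * q k) (∑ i, ∑ j, w i * w j * sphKernel d lam (x i) (x j)) := by
    have := hasSum_sum (s := Finset.univ) fun i (_ : i ∈ Finset.univ) =>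
      hasSum_sum (s := Finset.univ) fun j (_ : j ∈ Finset.univ) => (hs i j).mul_left (w i * w j)
    refine this.congr_fun ?_ |> fun h => h
    intro k
    simp only [hq, Finset.mul_sum]
    refine Finset.sum_congr rfl fun i _ => Finset.sum_congr rfl fun j _ => ?_
    ring
  refine ⟨hQ.nonneg fun k => mul_nonneg (hlam k) (hq0 k), fun L => ?_⟩
  set Q := ∑ i, ∑ j, w i * w j * sphKernel d lam (x i) (x j) with hQd
  set T := ∑ l ∈ Finset.range L, fmu c lam l with hT
  have hT0 : 0 ≤ T := Finset.sum_nonneg fun l _ => hm l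
  set A : Matrix (Fin n) (Fin n) ℝ := Matrix.of fun i j =>
    ∑ l ∈ Finset.range L, fmu c lam l * Geg d l ⟪x i, x j⟫ with hA
  have hAp : A.PosSemidef := by
    refine Matrix.PosSemidef.of_dotProduct_mulVec_nonneg ?_ ?_
    · ext i j
      simp [hA, Matrix.conjTranspose_apply, real_inner_comm]
    · intro v
      have : star v ⬝ᵥ A.mulVec v = ∑ l ∈ Finset.range L, fmu c lam l *
          ∑ i, ∑ j, v i * v j * Geg d l ⟪x i, x j⟫ := by
        simp only [dotProduct, Matrix.mulVec, hA, Matrix.of_apply, Pi.star_apply, star_trivial,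
          Finset.mul_sum, Finset.sum_mul]
        calc _ = ∑ i, ∑ l ∈ Finset.range L, ∑ j,
              v i * (fmu c lam l * Geg d l ⟪x i, x j⟫ * v j) :=
              Finset.sum_congr rfl fun i _ => Finset.sum_comm
          _ = ∑ l ∈ Finset.range L, ∑ i, ∑ j,
              v i * (fmu c lam l * Geg d l ⟪x i, x j⟫ * v j) := Finset.sum_comm
          _ = _ := by
              refine Finset.sum_congr rfl fun l _ => Finset.sum_congr rfl fun i _ =>
                Finset.sum_congr rfl fun j _ => ?_
              ring
      rw [this]
      exact Finset.sum_nonneg fun l _ => mul_nonneg (hm l) (Geg_psd d hd v x hx l)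
  have hv := vybiral_sq A hAp w
  have hdiag : ∀ i, A i i = T := by
    intro i
    have : ⟪x i, x i⟫ = 1 := by rw [real_inner_self_eq_norm_sq, hx i]; norm_num
    simp only [hA, Matrix.of_apply, this, Geg_at_one d hd, hT, mul_one]
  have htr : ∑ i, w i * A i i = T * ∑ j, w j := by
    simp only [hdiag]
    rw [← Finset.sum_mul, mul_comm]
  rw [htr] at hv
  refine hv.trans (mul_le_mul_of_nonneg_left ?_ (Nat.cast_nonneg n))
  set cv : ℕ → ℝ := fun k => ∑ l ∈ Finset.range L, ∑ s ∈ Finset.range L,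
    fmu c lam l * fmu c lam s * gC d k l s with hcv
  have hAA : ∀ i j, A i j * A i j = ∑ k ∈ Finset.range (2 * L), cv k * Geg d k ⟪x i, x j⟫ := by
    intro i j
    simp only [hA, Matrix.of_apply, hcv, Finset.sum_mul_sum]
    simp only [Finset.sum_mul]
    symm
    rw [Finset.sum_comm]
    refine Finset.sum_congr rfl fun l hl => ?_
    rw [Finset.sum_comm]
    refine Finset.sum_congr rfl fun s hs' => ?_
    rw [Finset.mem_range] at hl hs'
    have := Geg_mul d hd ⟪x i, x j⟫ s l (2 * L) (by omega)
    rw [mul_mul_mul_comm, this, Finset.mul_sum]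
    refine Finset.sum_congr rfl fun k _ => ?_
    ring
  have hsumA : ∑ i, ∑ j, w i * w j * (A i j * A i j) = ∑ k ∈ Finset.range (2 * L), cv k * q k := by
    simp only [hAA, hq, Finset.mul_sum]
    calc _ = ∑ i, ∑ k ∈ Finset.range (2 * L), ∑ j, w i * w j * (cv k * Geg d k ⟪x i, x j⟫) :=
          Finset.sum_congr rfl fun i _ => Finset.sum_comm
      _ = ∑ k ∈ Finset.range (2 * L), ∑ i, ∑ j, w i * w j * (cv k * Geg d k ⟪x i, x j⟫) :=
          Finset.sum_comm
      _ = _ := by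
          refine Finset.sum_congr rfl fun l _ => Finset.sum_congr rfl fun i _ =>
            Finset.sum_congr rfl fun j _ => ?_
          ring
  rw [hsumA]
  calc _ ≤ ∑ k ∈ Finset.range (2 * L), 2 * c * T * (lam k * q k) := by
        refine Finset.sum_le_sum fun k _ => ?_
        have := mul_le_mul_of_nonneg_right (conv_bound d hd lam hlam hmono c hc hch k L) (hq0 k)
        refine this.trans_eq ?_
        ring
    _ = 2 * c * T * ∑ k ∈ Finset.range (2 * L), lam k * q k := (Finset.mul_sum _ _ _).symm
    _ ≤ _ := by
        refine mul_le_mul_of_nonneg_left ?_ (by positivity)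
        exact sum_le_hasSum _ (fun k _ => mul_nonneg (hlam k) (hq0 k)) hQ

end Final


/-- For a nonnegative nonincreasing summable sequence `Λ̃` and `c > 1` with
`h_{⌊ℓ/2⌋}² ≤ c h_ℓ²`, one has
`e_n(H_Λ̃)² ≥ λ̃₀ (1 − 2cn λ̃₀ / (∑_{ℓ≥1} λ̃_{2ℓ} + 2c λ̃₀))`. -/
theorem stmt14 (d : ℕ) (hd : 2 ≤ d) (lam : ℕ → ℝ)
    (hlam : ∀ k, 0 ≤ lam k) (hmono : ∀ k l, k ≤ l → lam l ≤ lam k) (hsum : Summable lam)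
    (c : ℝ) (hc : 1 < c) (hch : ∀ ℓ : ℕ, hsqG d (ℓ / 2) ≤ c * hsqG d ℓ) (n : ℕ) :
    lam 0 * (1 - 2 * c * n * lam 0 /
        ((∑' ℓ : ℕ, lam (2 * (ℓ + 1))) + 2 * c * lam 0)) ≤ enSq d n lam := by
  have hne : Nonempty (Metric.sphere (0 : EuclideanSpace ℝ (Fin (d + 1))) 1) :=
    (NormedSpace.sphere_nonempty.2 zero_le_one).to_subtype
  unfold enSq
  refine le_ciInf fun w => le_ciInf fun x => ?_
  have hx : ∀ j, ‖(x j : EuclideanSpace ℝ (Fin (d + 1)))‖ = 1 := fun j => by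
    simpa using (x j).2
  obtain ⟨hQ0, hL⟩ := main_ineq d hd lam hlam hmono hsum c hc hch n w (fun j => x j) hx
  have hsw : n = 0 → ∑ j, w j = 0 := by
    rintro rfl; simp
  set Q := ∑ j, ∑ k, w j * w k * sphKernel d lam (x j) (x k) with hQ
  set S := ∑ j, w j with hS
  set T := ∑' ℓ : ℕ, lam (2 * (ℓ + 1)) with hT
  have hs2 : Summable fun ℓ : ℕ => lam (2 * (ℓ + 1)) :=
    hsum.comp_injective (i := fun ℓ : ℕ => 2 * (ℓ + 1)) fun a b h => by
      simp only at h; omega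
  have hT0 : 0 ≤ T := tsum_nonneg fun _ => hlam _
  rcases (hlam 0).eq_or_lt with h0 | h0
  · rw [← h0]; simpa using hQ0
  have hcl : 0 < 2 * c * lam 0 := by positivity
  have hlim : (T + 2 * c * lam 0) * S ^ 2 ≤ n * (2 * c * Q) := by
    have hfin : ∀ L, (∑ ℓ ∈ Finset.range L, lam (2 * (ℓ + 1)) + 2 * c * lam 0) * S ^ 2 ≤
        n * (2 * c * Q) := by
      intro L
      have h := hL (L + 1)
      have e : ∑ l ∈ Finset.range (L + 1), fmu c lam l =
          ∑ ℓ ∈ Finset.range L, lam (2 * (ℓ + 1)) + 2 * c * lam 0 := by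
        rw [Finset.sum_range_succ']
        simp [fmu]
      rw [e] at h
      have hp : 0 < ∑ ℓ ∈ Finset.range L, lam (2 * (ℓ + 1)) + 2 * c * lam 0 :=
        add_pos_of_nonneg_of_pos (Finset.sum_nonneg fun _ _ => hlam _) hcl
      refine le_of_mul_le_mul_left ?_ hp
      nlinarith [h]
    have ht := ((hs2.hasSum.tendsto_sum_nat.add_const (2 * c * lam 0)).mul_const (S ^ 2))
    exact le_of_tendsto' ht hfin
  have hD : 0 < T + 2 * c * lam 0 := by linarith
  rcases Nat.eq_zero_or_pos n with hn | hn
  · rw [hsw hn, hn]; simpa using hQ0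
  have hn' : (0 : ℝ) < n := by exact_mod_cast hn
  have hnc : 0 < (n : ℝ) * (2 * c) := by positivity
  set D := T + 2 * c * lam 0 with hDd
  have e : lam 0 * (1 - 2 * c * n * lam 0 / D) = lam 0 - n * (2 * c) * lam 0 ^ 2 / D := by
    field_simp
  rw [e]
  have hQl : D * S ^ 2 / (n * (2 * c)) ≤ Q := by
    rw [div_le_iff₀ hnc]; linarith
  have hsq : 0 ≤ (D * S - n * (2 * c) * lam 0) ^ 2 / (D * (n * (2 * c))) := by positivity
  have e2 : (D * S - n * (2 * c) * lam 0) ^ 2 / (D * (n * (2 * c))) =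
      D * S ^ 2 / (n * (2 * c)) - 2 * lam 0 * S + n * (2 * c) * lam 0 ^ 2 / D := by
    field_simp
    ring
  linarith
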